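/- Suppose Δ₁ = ∑_{j=1}^m f_j − ∑_{j=m+1}^q B_j f_j + ∑_{j=1}^n e_j − ∑_{j=n+1}^p A_j e_j > 0 and z is a nonzero complex number with |arg z| < Δ₁π/2. Then for any admissible abscissa c the integrand t ↦ θ(c + it) z^{−(c+it)} is (absolutely) integrable over t ∈ ℝ; that is, the vertical-line integral defining the Î-function Î_{p,q}^{m,n}[z] converges absolutely. -/

import Mathlib

open MeasureTheory Complex Set

/-- The Mellin–Barnes integrand kernel `θ(s)` of the Î-function. -/
noncomputable def theta (m n p q : ℕ) (a b : ℕ → ℂ) (e f A B : ℕ → ℝ) (s : ℂ) : ℂ :=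
  ((∏ j ∈ Finset.Icc 1 m, Complex.Gamma (b j + (f j : ℂ) * s)) *
      ∏ j ∈ Finset.Icc 1 n, Complex.Gamma (1 - a j - (e j : ℂ) * s)) /
    ((∏ j ∈ Finset.Icc (m + 1) q, Complex.Gamma (1 - b j - (f j : ℂ) * s) ^ (B j : ℂ)) *
      ∏ j ∈ Finset.Icc (n + 1) p, Complex.Gamma (a j + (e j : ℂ) * s) ^ (A j : ℂ))

/-- The integrand `t ↦ θ(c + it) z^{-(c+it)}` of the vertical-line integral defining `Î`. -/
noncomputable def IhatIntegrand (m n p q : ℕ) (a b : ℕ → ℂ) (e f A B : ℕ → ℝ)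
    (z : ℂ) (c : ℝ) (t : ℝ) : ℂ :=
  theta m n p q a b e f A B ((c : ℂ) + (t : ℂ) * Complex.I) *
    z ^ (-((c : ℂ) + (t : ℂ) * Complex.I))

/-- The Î-function `Î_{p,q}^{m,n}[z]`, as a vertical-line integral over the abscissa `c`
(`ds = i dt`, so `(1/(2πi)) ∫ ds = (1/(2π)) ∫ dt`). -/
noncomputable def Ihat (m n p q : ℕ) (a b : ℕ → ℂ) (e f A B : ℕ → ℝ) (z : ℂ) (c : ℝ) : ℂ :=
  (1 / (2 * (Real.pi : ℂ))) * ∫ t : ℝ, IhatIntegrand m n p q a b e f A B z c t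

/-- The convergence parameter `Δ₁`. -/
noncomputable def delta1 (m n p q : ℕ) (e f A B : ℕ → ℝ) : ℝ :=
  ∑ j ∈ Finset.Icc 1 m, f j - ∑ j ∈ Finset.Icc (m + 1) q, B j * f j +
    ∑ j ∈ Finset.Icc 1 n, e j - ∑ j ∈ Finset.Icc (n + 1) p, A j * e j

/-- Admissibility of the real abscissa `c`:
`-min_{1≤j≤m} Re(b_j/f_j) < c < min_{1≤j≤n} Re((1-a_j)/e_j)`. -/
def admissible (m n : ℕ) (a b : ℕ → ℂ) (e f : ℕ → ℝ) (c : ℝ) : Prop :=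
  (∀ j ∈ Finset.Icc 1 m, -(b j / (f j : ℂ)).re < c) ∧
    ∀ j ∈ Finset.Icc 1 n, c < ((1 - a j) / (e j : ℂ)).re

theorem integrableOn_rpow_mul_exp_neg_mul {s k : ℝ} (hs : -1 < s) (hk : 0 < k) :
    IntegrableOn (fun t : ℝ => t ^ s * Real.exp (-(k * t))) (Ioi 0) := by
  simpa using integrableOn_rpow_mul_exp_neg_mul_rpow hs one_pos hk

theorem norm_cpow_mul_exp_neg_mul (a r : ℂ) {t : ℝ} (ht : 0 < t) :
    ‖(t : ℂ) ^ (a - 1) * cexp (-(r * t))‖ = t ^ (a.re - 1) * Real.exp (-(r.re * t)) := by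
  rw [norm_mul, norm_cpow_eq_rpow_re_of_pos ht, Complex.norm_exp]
  simp

theorem aestronglyMeasurable_cpow_mul_exp_neg_mul (a r : ℂ) :
    AEStronglyMeasurable (fun t : ℝ => (t : ℂ) ^ (a - 1) * cexp (-(r * t)))
      (volume.restrict (Ioi 0)) :=
  Measurable.aestronglyMeasurable (by fun_prop)

theorem integrableOn_cpow_mul_exp_neg_mul {a r : ℂ} (ha : 0 < a.re) (hr : 0 < r.re) :
    IntegrableOn (fun t : ℝ => (t : ℂ) ^ (a - 1) * cexp (-(r * t))) (Ioi 0) := by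
  refine Integrable.mono' (integrableOn_rpow_mul_exp_neg_mul (s := a.re - 1) (by linarith) hr)
    (aestronglyMeasurable_cpow_mul_exp_neg_mul a r) ?_
  filter_upwards [ae_restrict_mem measurableSet_Ioi] with t ht
  exact (norm_cpow_mul_exp_neg_mul a r ht).le

theorem differentiableAt_integral_cpow_mul_exp_neg_mul {a r : ℂ} (ha : 0 < a.re) (hr : 0 < r.re) :
    DifferentiableAt ℂ
      (fun r : ℂ => ∫ t : ℝ in Ioi 0, (t : ℂ) ^ (a - 1) * cexp (-(r * t))) r := by
  refine (hasDerivAt_integral_of_dominated_loc_of_deriv_le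
    (F' := fun (r : ℂ) (t : ℝ) => (t : ℂ) ^ (a - 1) * (cexp (-(r * t)) * (-(1 * t))))
    (bound := fun t : ℝ => t ^ a.re * Real.exp (-(r.re / 2 * t)))
    (Metric.ball_mem_nhds r (half_pos hr))
    (.of_forall fun w => aestronglyMeasurable_cpow_mul_exp_neg_mul a w)
    (integrableOn_cpow_mul_exp_neg_mul ha hr)
    (Measurable.aestronglyMeasurable (by fun_prop)) ?_
    (integrableOn_rpow_mul_exp_neg_mul (by linarith) (half_pos hr)) ?_).2.differentiableAt
  · filter_upwards [ae_restrict_mem measurableSet_Ioi] with t ht w hw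
    have ht : 0 < t := ht
    have hw : r.re / 2 < w.re := by
      have := (abs_re_le_norm (w - r)).trans_lt (mem_ball_iff_norm.mp hw)
      rw [sub_re] at this
      linarith [(abs_lt.mp this).1]
    rw [← mul_assoc, norm_mul, norm_cpow_mul_exp_neg_mul a w ht, one_mul, norm_neg,
      Complex.norm_of_nonneg ht.le, mul_right_comm, ← Real.rpow_add_one ht.ne', sub_add_cancel]
    gcongr
  · filter_upwards with t w _
    exact ((((hasDerivAt_id w).mul_const (t : ℂ)).neg).cexp).const_mul _

theorem integral_cpow_mul_cexp_neg_mul_Ioi {a r : ℂ} (ha : 0 < a.re) (hr : 0 < r.re) :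
    ∫ t : ℝ in Ioi 0, (t : ℂ) ^ (a - 1) * cexp (-(r * t)) = (1 / r) ^ a * Gamma a := by
  have hopen : IsOpen {w : ℂ | 0 < w.re} := isOpen_lt continuous_const continuous_re
  have hF : AnalyticOnNhd ℂ
      (fun r : ℂ => ∫ t : ℝ in Ioi 0, (t : ℂ) ^ (a - 1) * cexp (-(r * t))) {w : ℂ | 0 < w.re} :=
    DifferentiableOn.analyticOnNhd (fun w hw =>
      (differentiableAt_integral_cpow_mul_exp_neg_mul ha hw).differentiableWithinAt) hopen
  have hG : AnalyticOnNhd ℂ (fun r : ℂ => (1 / r) ^ a * Gamma a) {w : ℂ | 0 < w.re} := by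
    refine DifferentiableOn.analyticOnNhd (fun w hw => ?_) hopen
    have hw : 0 < w.re := hw
    have hw0 : w ≠ 0 := by rintro rfl; simp at hw
    have hslit : 1 / w ∈ slitPlane := by
      left
      rw [one_div, inv_re]
      exact div_pos hw (normSq_pos.mpr hw0)
    exact (((by fun_prop (disch := exact hw0) : DifferentiableAt ℂ (fun r : ℂ => 1 / r) w).cpow_const
      hslit).mul_const _).differentiableWithinAt
  refine hF.eqOn_of_preconnected_of_frequently_eq hG (convex_halfSpace_re_gt 0).isPreconnected
    (z₀ := 1) (by simp) ?_ hr
  have htend : Filter.Tendsto (fun x : ℝ => (x : ℂ)) (nhdsWithin 1 {1}ᶜ) (nhdsWithin 1 {1}ᶜ) := by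
    refine tendsto_nhdsWithin_iff.mpr ⟨?_, ?_⟩
    · exact (continuous_ofReal.tendsto' 1 1 (by simp)).mono_left nhdsWithin_le_nhds
    · filter_upwards [self_mem_nhdsWithin] with x hx
      simpa using hx
  refine htend.frequently (Filter.Eventually.frequently ?_)
  filter_upwards [nhdsWithin_le_nhds (lt_mem_nhds (one_pos : (0 : ℝ) < 1))] with x hx
  exact Complex.integral_cpow_mul_exp_neg_mul_Ioi ha hx

theorem norm_Gamma_le_mul_exp {φ : ℝ} (hφ : φ ∈ Ioo 0 (Real.pi / 2)) {x : ℝ} (hx : 0 < x) :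
    ∃ C, 0 ≤ C ∧ ∀ y : ℝ, ‖Gamma (x + y * I)‖ ≤ C * Real.exp (-(φ * |y|)) := by
  have key : ∀ ψ ∈ Ioo (-(Real.pi / 2)) (Real.pi / 2), ∀ y : ℝ,
      ‖Gamma (x + y * I)‖ ≤
        (1 / Real.cos ψ) ^ x * Real.Gamma x * Real.exp (-(ψ * y)) := by
    intro ψ hψ y
    have hcos : 0 < Real.cos ψ := Real.cos_pos_of_mem_Ioo hψ
    have ha : 0 < (x + y * I : ℂ).re := by simpa using hx
    have hre : (cexp (ψ * I)).re = Real.cos ψ := exp_ofReal_mul_I_re ψ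
    have h := integral_cpow_mul_cexp_neg_mul_Ioi (r := cexp (ψ * I)) ha (by rwa [hre])
    have harg : (cexp (-(ψ * I))).arg = -ψ := by
      rw [← neg_mul, ← ofReal_neg, arg_exp_mul_I, toIocMod_eq_self]
      constructor <;> linarith [hψ.1, hψ.2, Real.pi_pos]
    have hnorm : ‖(1 / cexp (ψ * I)) ^ (x + y * I : ℂ)‖ = Real.exp (ψ * y) := by
      rw [one_div, ← Complex.exp_neg, norm_cpow_of_ne_zero (exp_ne_zero _), harg, Complex.norm_exp]
      simp [← Real.exp_neg]
    have hle : Real.exp (ψ * y) * ‖Gamma (x + y * I)‖ ≤ (1 / Real.cos ψ) ^ x * Real.Gamma x := by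
      rw [← hnorm, ← norm_mul, ← h, ← Real.integral_rpow_mul_exp_neg_mul_Ioi hx hcos]
      refine (norm_integral_le_integral_norm _).trans_eq ?_
      refine setIntegral_congr_fun measurableSet_Ioi fun t ht => ?_
      simp only [norm_cpow_mul_exp_neg_mul _ _ ht, hre]
      simp
    rw [Real.exp_neg, ← div_eq_mul_inv, le_div_iff₀ (Real.exp_pos _), mul_comm]
    exact hle
  have hφ' : φ ∈ Ioo (-(Real.pi / 2)) (Real.pi / 2) := ⟨by linarith [hφ.1, Real.pi_pos], hφ.2⟩
  have hnφ : -φ ∈ Ioo (-(Real.pi / 2)) (Real.pi / 2) :=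
    ⟨by linarith [hφ.2], by linarith [hφ.1, Real.pi_pos]⟩
  have hcos : 0 < Real.cos φ := Real.cos_pos_of_mem_Ioo hφ'
  refine ⟨(1 / Real.cos φ) ^ x * Real.Gamma x, by have := Real.Gamma_pos_of_pos hx; positivity,
    fun y => ?_⟩
  rcases le_total 0 y with hy | hy
  · simpa [abs_of_nonneg hy] using key φ hφ' y
  · simpa [abs_of_nonpos hy] using key (-φ) hnφ y

theorem norm_sin_le_exp_abs_im (w : ℂ) : ‖sin w‖ ≤ Real.exp |w.im| := by
  rw [Complex.sin, norm_div, norm_mul, norm_I, mul_one, Complex.norm_ofNat]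
  refine (div_le_iff₀ two_pos).mpr ((norm_sub_le _ _).trans ?_)
  have h₁ : ‖cexp (-w * I)‖ ≤ Real.exp |w.im| := by
    rw [Complex.norm_exp]; simpa using le_abs_self _
  have h₂ : ‖cexp (w * I)‖ ≤ Real.exp |w.im| := by
    rw [Complex.norm_exp]; simpa using neg_le_abs _
  linarith

theorem norm_inv_Gamma_le_mul_exp {k : ℝ} (hk : Real.pi / 2 < k) (x : ℝ) :
    ∃ C, 0 ≤ C ∧ ∀ y : ℝ, ‖(Gamma (x + y * I))⁻¹‖ ≤ C * Real.exp (k * |y|) := by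
  have hpi := Real.pi_pos
  obtain ⟨N, hN⟩ := exists_nat_gt x
  induction N generalizing x with
  | zero =>
    obtain ⟨φ, hφ₁, hφ₂⟩ := exists_between
      (max_lt (by linarith : Real.pi - k < Real.pi / 2) (by linarith : (0 : ℝ) < Real.pi / 2))
    obtain ⟨C, hC, h⟩ := norm_Gamma_le_mul_exp (φ := φ)
      ⟨(le_max_right _ _).trans_lt hφ₁, hφ₂⟩ (x := 1 - x) (by push_cast at hN; linarith)
    refine ⟨C, hC, fun y => ?_⟩
    have hΓ := h (-y)
    have hs : (((1 - x : ℝ) : ℂ) + ((-y : ℝ) : ℂ) * I) = 1 - (x + y * I) := by push_cast; ring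
    rw [hs, abs_neg] at hΓ
    have hrefl := Gamma_mul_Gamma_one_sub (x + y * I)
    by_cases h0 : Gamma (x + y * I) = 0
    · rw [h0]; simp; positivity
    have hre : 0 < (1 - (x + y * I) : ℂ).re := by
      simp; push_cast at hN; linarith
    have hsin : sin (Real.pi * (x + y * I)) ≠ 0 := by
      intro hcon
      rw [hcon, div_zero] at hrefl
      exact mul_ne_zero h0 (Gamma_ne_zero_of_re_pos hre) hrefl
    have hinv : (Gamma (x + y * I))⁻¹ =
        Gamma (1 - (x + y * I)) * sin (Real.pi * (x + y * I)) / Real.pi := by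
      rw [eq_div_iff hsin] at hrefl
      rw [inv_eq_iff_eq_inv, ← one_div, eq_div_iff, ← mul_div_assoc, ← mul_assoc, hrefl, div_self]
      · exact_mod_cast hpi.ne'
      · exact div_ne_zero (mul_ne_zero (Gamma_ne_zero_of_re_pos hre) hsin)
          (by exact_mod_cast hpi.ne')
    have hsinle := norm_sin_le_exp_abs_im (Real.pi * (x + y * I))
    have him : |((Real.pi : ℂ) * (x + y * I)).im| = Real.pi * |y| := by
      simp [abs_mul, abs_of_pos hpi]
    rw [him] at hsinle
    rw [hinv, norm_div, norm_mul, Complex.norm_of_nonneg hpi.le]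
    calc _ ≤ ‖Gamma (1 - (x + y * I))‖ * ‖sin (Real.pi * (x + y * I))‖ :=
          div_le_self (by positivity) (by linarith [Real.pi_gt_three])
      _ ≤ C * Real.exp (-(φ * |y|)) * Real.exp (Real.pi * |y|) := by gcongr
      _ = C * Real.exp ((Real.pi - φ) * |y|) := by
          rw [mul_assoc, ← Real.exp_add]; ring_nf
      _ ≤ C * Real.exp (k * |y|) := by
          gcongr
          linarith [(le_max_left _ _).trans_lt hφ₁]
  | succ N ih =>
    obtain ⟨C, hC, h⟩ := ih (x - 1) (by push_cast at hN; linarith)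
    have hcont : Continuous fun y : ℝ => (Gamma (x + y * I))⁻¹ :=
      differentiable_one_div_Gamma.continuous.comp (by fun_prop)
    obtain ⟨D, hD⟩ := (isCompact_Icc (a := (-1 : ℝ)) (b := 1)).exists_bound_of_continuousOn
      hcont.continuousOn
    refine ⟨max C D, le_max_of_le_left hC, fun y => ?_⟩
    rcases le_total |y| 1 with hy | hy
    · calc _ ≤ D := hD y (abs_le.mp hy)
        _ ≤ max C D := le_max_right _ _
        _ ≤ _ := le_mul_of_one_le_right (le_max_of_le_left hC)
            (Real.one_le_exp (mul_nonneg (by linarith) (abs_nonneg y)))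
    · have hs : (x + y * I : ℂ) = ((x - 1 : ℝ) + y * I) + 1 := by push_cast; ring
      set s : ℂ := (x - 1 : ℝ) + y * I with hsdef
      have hs1 : 1 ≤ ‖s‖ := hy.trans (by simpa [hsdef] using abs_im_le_norm s)
      have hs0 : s ≠ 0 := norm_pos_iff.mp (one_pos.trans_le hs1)
      rw [hs, Gamma_add_one s hs0, mul_inv, norm_mul, norm_inv]
      calc _ ≤ ‖(Gamma s)⁻¹‖ := mul_le_of_le_one_left (norm_nonneg _) (inv_le_one_of_one_le₀ hs1)
        _ ≤ C * Real.exp (k * |y|) := h y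
        _ ≤ _ := by gcongr; exact le_max_left _ _

theorem Gamma_vertical_line_isBigO {φ : ℝ} (hφ : φ ∈ Ioo 0 (Real.pi / 2)) {w : ℂ}
    (hw : 0 < w.re) (g : ℝ) :
    (fun t : ℝ => Gamma (w + g * t * I)) =O[⊤] fun t : ℝ => Real.exp (-(φ * |g|) * |t|) := by
  obtain ⟨C, hC, h⟩ := norm_Gamma_le_mul_exp hφ hw
  refine Asymptotics.isBigO_top.mpr ⟨C * Real.exp (φ * |w.im|), fun t => ?_⟩
  have hs : (w + g * t * I : ℂ) = w.re + ((w.im + g * t : ℝ) : ℂ) * I := by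
    conv_lhs => rw [← re_add_im w]
    push_cast; ring
  have habs : |g| * |t| - |w.im| ≤ |w.im + g * t| := by
    have := abs_sub (w.im + g * t) w.im
    rw [add_sub_cancel_left, abs_mul] at this
    linarith
  rw [hs, Real.norm_eq_abs, Real.abs_exp, mul_assoc, ← Real.exp_add]
  refine (h _).trans ?_
  gcongr
  nlinarith [mul_le_mul_of_nonneg_left habs hφ.1.le]

theorem inv_Gamma_vertical_line_isBigO {k : ℝ} (hk : Real.pi / 2 < k) (w : ℂ) (g : ℝ) :
    (fun t : ℝ => (Gamma (w + g * t * I))⁻¹) =O[⊤] fun t : ℝ => Real.exp (k * |g| * |t|) := by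
  obtain ⟨C, hC, h⟩ := norm_inv_Gamma_le_mul_exp hk w.re
  have hk0 : 0 ≤ k := by linarith [Real.pi_pos]
  refine Asymptotics.isBigO_top.mpr ⟨C * Real.exp (k * |w.im|), fun t => ?_⟩
  have hs : (w + g * t * I : ℂ) = w.re + ((w.im + g * t : ℝ) : ℂ) * I := by
    conv_lhs => rw [← re_add_im w]
    push_cast; ring
  have habs : |w.im + g * t| ≤ |w.im| + |g| * |t| := by
    simpa [abs_mul] using abs_add_le w.im (g * t)
  rw [hs, Real.norm_eq_abs, Real.abs_exp, mul_assoc, ← Real.exp_add]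
  refine (h _).trans ?_
  gcongr
  nlinarith [mul_le_mul_of_nonneg_left habs hk0]

theorem inv_Gamma_cpow_vertical_line_isBigO {k : ℝ} (hk : Real.pi / 2 < k) (w : ℂ) (g : ℝ)
    {r : ℝ} (hr : 0 ≤ r) :
    (fun t : ℝ => (Gamma (w + g * t * I) ^ (r : ℂ))⁻¹) =O[⊤]
      fun t : ℝ => Real.exp (k * (r * |g|) * |t|) := by
  have h := (inv_Gamma_vertical_line_isBigO hk w g).norm_left.rpow hr
    (.of_forall fun t => (Real.exp_pos _).le)
  refine Asymptotics.IsBigO.of_norm_left ?_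
  convert h using 2 with t t
  · rw [norm_inv, norm_cpow_real, norm_inv, Real.inv_rpow (norm_nonneg _)]
  · rw [← Real.exp_mul]; ring_nf

theorem prod_isBigO_exp_mul {ι : Type*} {s : Finset ι} {F : ι → ℝ → ℂ} {k : ι → ℝ} {K : ℝ}
    (h : ∀ j ∈ s, F j =O[⊤] fun t : ℝ => Real.exp (K * k j * |t|)) :
    (fun t => ∏ j ∈ s, F j t) =O[⊤] fun t : ℝ => Real.exp (K * (∑ j ∈ s, k j) * |t|) := by
  simpa only [← Real.exp_sum, ← Finset.sum_mul, ← Finset.mul_sum] using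
    Asymptotics.IsBigO.finsetProd h

theorem cpow_neg_vertical_line_isBigO {z : ℂ} (hz : z ≠ 0) (c : ℝ) :
    (fun t : ℝ => z ^ (-((c : ℂ) + (t : ℂ) * I))) =O[⊤]
      fun t : ℝ => Real.exp (|z.arg| * |t|) := by
  refine Asymptotics.isBigO_top.mpr ⟨‖z‖ ^ (-c), fun t => ?_⟩
  rw [norm_cpow_of_ne_zero hz, Real.norm_eq_abs, Real.abs_exp, div_eq_mul_inv, ← Real.exp_neg]
  simp only [neg_re, add_re, ofReal_re, mul_re, I_re, mul_zero, ofReal_im, I_im, mul_one,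
    sub_self, add_zero, neg_im, add_im, mul_im, zero_add, mul_neg, neg_neg]
  rw [← abs_mul]
  gcongr
  exact le_abs_self _

theorem measurable_Gamma : Measurable Gamma := by
  have h : Measurable fun s => ((Gamma s)⁻¹)⁻¹ :=
    differentiable_one_div_Gamma.continuous.measurable.inv
  simpa using h

theorem measurable_IhatIntegrand (m n p q : ℕ) (a b : ℕ → ℂ) (e f A B : ℕ → ℝ) (z : ℂ) (c : ℝ) :
    Measurable (IhatIntegrand m n p q a b e f A B z c) := by
  have := measurable_Gamma
  unfold IhatIntegrand theta
  fun_prop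

theorem integrable_exp_neg_mul_abs {k : ℝ} (hk : 0 < k) :
    Integrable fun t : ℝ => Real.exp (-k * |t|) := by
  rw [← integrableOn_univ, ← Iic_union_Ioi (a := (0 : ℝ))]
  refine IntegrableOn.union ?_ ?_
  · refine (integrableOn_exp_mul_Iic hk 0).congr_fun (fun t ht => ?_) measurableSet_Iic
    simp [abs_of_nonpos (mem_Iic.mp ht)]
  · refine (integrableOn_exp_mul_Ioi (neg_lt_zero.mpr hk) 0).congr_fun (fun t ht => ?_)
      measurableSet_Ioi
    simp [abs_of_pos (mem_Ioi.mp ht)]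

theorem theta_vertical_line_isBigO {m n p q : ℕ} (hmq : m ≤ q) (hnp : n ≤ p)
    {a b : ℕ → ℂ} {e f A B : ℕ → ℝ}
    (he : ∀ j ∈ Finset.Icc 1 p, 0 < e j) (hf : ∀ j ∈ Finset.Icc 1 q, 0 < f j)
    (hA : ∀ j ∈ Finset.Icc (n + 1) p, 0 < A j) (hB : ∀ j ∈ Finset.Icc (m + 1) q, 0 < B j)
    {c : ℝ} (hc : admissible m n a b e f c)
    {φ k : ℝ} (hφ : φ ∈ Ioo 0 (Real.pi / 2)) (hk : Real.pi / 2 < k) :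
    (fun t : ℝ => theta m n p q a b e f A B (c + t * I)) =O[⊤] fun t : ℝ => Real.exp
      ((-φ * (∑ j ∈ Finset.Icc 1 m, f j + ∑ j ∈ Finset.Icc 1 n, e j) +
        k * (∑ j ∈ Finset.Icc (m + 1) q, B j * f j +
          ∑ j ∈ Finset.Icc (n + 1) p, A j * e j)) * |t|) := by
  have h₁ : (fun t : ℝ => ∏ j ∈ Finset.Icc 1 m, Gamma (b j + (f j : ℂ) * (c + t * I))) =O[⊤]
      fun t : ℝ => Real.exp (-φ * (∑ j ∈ Finset.Icc 1 m, f j) * |t|) := by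
    refine prod_isBigO_exp_mul fun j hj => ?_
    have hfj : 0 < f j := hf j (Finset.Icc_subset_Icc_right hmq hj)
    have hre : 0 < (b j + f j * c : ℂ).re := by
      have := hc.1 j hj
      rw [div_ofReal_re, ← neg_div, div_lt_iff₀ hfj] at this
      simp
      linarith
    convert! Gamma_vertical_line_isBigO hφ hre (f j) using 3
    · ring
    · rw [abs_of_pos hfj]; ring
  have h₂ : (fun t : ℝ => ∏ j ∈ Finset.Icc 1 n, Gamma (1 - a j - (e j : ℂ) * (c + t * I))) =O[⊤]
      fun t : ℝ => Real.exp (-φ * (∑ j ∈ Finset.Icc 1 n, e j) * |t|) := by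
    refine prod_isBigO_exp_mul fun j hj => ?_
    have hej : 0 < e j := he j (Finset.Icc_subset_Icc_right hnp hj)
    have hre : 0 < (1 - a j - e j * c : ℂ).re := by
      have := hc.2 j hj
      rw [div_ofReal_re, lt_div_iff₀ hej] at this
      simp at this ⊢
      linarith
    convert! Gamma_vertical_line_isBigO hφ hre (-e j) using 3
    · push_cast; ring
    · rw [abs_neg, abs_of_pos hej]; ring
  have h₃ : (fun t : ℝ => ∏ j ∈ Finset.Icc (m + 1) q,
        (Gamma (1 - b j - (f j : ℂ) * (c + t * I)) ^ (B j : ℂ))⁻¹) =O[⊤]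
      fun t : ℝ => Real.exp (k * (∑ j ∈ Finset.Icc (m + 1) q, B j * f j) * |t|) := by
    refine prod_isBigO_exp_mul fun j hj => ?_
    have hfj : 0 < f j := hf j (Finset.Icc_subset_Icc_left (by lia) hj)
    convert! inv_Gamma_cpow_vertical_line_isBigO hk (1 - b j - f j * c) (-f j) (hB j hj).le using 5
    · push_cast; ring
    · rw [abs_neg, abs_of_pos hfj]
  have h₄ : (fun t : ℝ => ∏ j ∈ Finset.Icc (n + 1) p,
        (Gamma (a j + (e j : ℂ) * (c + t * I)) ^ (A j : ℂ))⁻¹) =O[⊤]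
      fun t : ℝ => Real.exp (k * (∑ j ∈ Finset.Icc (n + 1) p, A j * e j) * |t|) := by
    refine prod_isBigO_exp_mul fun j hj => ?_
    have hej : 0 < e j := he j (Finset.Icc_subset_Icc_left (by lia) hj)
    convert! inv_Gamma_cpow_vertical_line_isBigO hk (a j + e j * c) (e j) (hA j hj).le using 5
    · ring
    · rw [abs_of_pos hej]
  convert! (h₁.mul h₂).mul (h₃.mul h₄) using 2 with t t
  · rw [theta, div_eq_mul_inv, mul_inv, Finset.prod_inv_distrib, Finset.prod_inv_distrib]
  · rw [← Real.exp_add, ← Real.exp_add, ← Real.exp_add]; ring_nf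

/-- if `Δ₁ > 0`, `z ≠ 0` and `|arg z| < Δ₁ π / 2`, then for any admissible
abscissa `c` the integrand `t ↦ θ(c+it) z^{-(c+it)}` is absolutely integrable over `ℝ`,
i.e. the vertical-line integral defining `Î_{p,q}^{m,n}[z]` converges absolutely. -/
theorem Ihat_integrand_integrable
    (m n p q : ℕ) (hmq : m ≤ q) (hnp : n ≤ p)
    (a b : ℕ → ℂ) (e f A B : ℕ → ℝ)
    (he : ∀ j ∈ Finset.Icc 1 p, 0 < e j) (hf : ∀ j ∈ Finset.Icc 1 q, 0 < f j)
    (hA : ∀ j ∈ Finset.Icc (n + 1) p, 0 < A j) (hB : ∀ j ∈ Finset.Icc (m + 1) q, 0 < B j)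
    (hΔ : 0 < delta1 m n p q e f A B)
    (z : ℂ) (hz : z ≠ 0)
    (harg : |z.arg| < delta1 m n p q e f A B * Real.pi / 2)
    (c : ℝ) (hc : admissible m n a b e f c) :
    Integrable (fun t : ℝ => IhatIntegrand m n p q a b e f A B z c t) := by
  set P := ∑ j ∈ Finset.Icc 1 m, f j + ∑ j ∈ Finset.Icc 1 n, e j with hP
  set Q := ∑ j ∈ Finset.Icc (m + 1) q, B j * f j + ∑ j ∈ Finset.Icc (n + 1) p, A j * e j with hQ
  have hΔPQ : delta1 m n p q e f A B = P - Q := by rw [delta1, hP, hQ]; ring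
  rw [hΔPQ] at harg
  have hlim : Filter.Tendsto (fun ε : ℝ => ε * (P + Q)) (nhdsWithin 0 (Ioi 0)) (nhds 0) :=
    ((continuous_id.mul continuous_const).tendsto' 0 0 (by simp)).mono_left nhdsWithin_le_nhds
  obtain ⟨ε, ⟨hεlt, hεpi⟩, hε⟩ := ((hlim.eventually_lt_const (sub_pos.mpr harg)).and
    (nhdsWithin_le_nhds (gt_mem_nhds Real.pi_div_two_pos))).and self_mem_nhdsWithin |>.exists
  have hε : 0 < ε := hε
  have hbound := (theta_vertical_line_isBigO hmq hnp he hf hA hB hc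
    (φ := Real.pi / 2 - ε) (k := Real.pi / 2 + ε) ⟨by linarith, by linarith⟩ (by linarith)).mul
    (cpow_neg_vertical_line_isBigO hz c)
  simp only [← hP, ← hQ, ← Real.exp_add, ← add_mul] at hbound
  obtain ⟨C, hC⟩ := Asymptotics.isBigO_top.mp hbound
  have hκ : 0 < -(-(Real.pi / 2 - ε) * P + (Real.pi / 2 + ε) * Q + |z.arg|) := by linarith
  have hint := (integrable_exp_neg_mul_abs hκ).norm.const_mul C
  rw [neg_neg] at hint
  exact hint.mono' (measurable_IhatIntegrand m n p q a b e f A B z c).aestronglyMeasurable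
    (.of_forall hC)
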